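/- arXiv:1504.02429 — 5 statements merged into one kernel-verified Lean document; each statement's English description precedes it below -/
import Mathlib

section
/- Truncated-weight lower bound on the distance to stationarity: for any pairing π of X, any x ∈ X, any t ≥ 1 and any θ ∈ (0,1), one has 1 − Σ_{y∈X} P^t_θ(x,y) ≤ D_x(t) + 1/(θN), where P^t_θ(x,y) is the contribution to P^t(x,y) from non-backtracking paths of weight at most θ. -/
open Classical Filter Finset

noncomputable section

/-- The set of half-edges: `deg v` half-edges attached to each vertex `v`. -/
abbrev HE (k : ℕ) (dg : Fin k → ℕ) : Type := (v : Fin k) × Fin (dg v)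

/-- A pairing is a fixed-point-free involution of the half-edges. -/
def IsPairing {k : ℕ} {dg : Fin k → ℕ} (π : Equiv.Perm (HE k dg)) : Prop :=
  (∀ x, π (π x) = x) ∧ ∀ x, π x ≠ x

/-- `N`, the total number of half-edges. -/
def Nh {k : ℕ} (dg : Fin k → ℕ) : ℕ := ∑ v, dg v

/-- The non-backtracking random walk transition matrix: from `x`, move to a uniformly
chosen neighbour of `π x` (a half-edge at the same vertex as `π x`, distinct from it). -/
def nbrwP {k : ℕ} (dg : Fin k → ℕ) (π : Equiv.Perm (HE k dg)) :
    Matrix (HE k dg) (HE k dg) ℝ := fun x y =>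
  if (π x).1 = y.1 ∧ π x ≠ y then ((dg (π x).1 : ℝ) - 1)⁻¹ else 0

/-- Total-variation distance to the uniform distribution at time `t`, from state `x`. -/
def Dx {k : ℕ} (dg : Fin k → ℕ) (π : Equiv.Perm (HE k dg)) (x : HE k dg) (t : ℕ) : ℝ :=
  (1 / 2) * ∑ y, |((nbrwP dg π) ^ t) x y - (Nh dg : ℝ)⁻¹|

/-- Worst-case total-variation distance to equilibrium at time `t`. -/
def Dmax {k : ℕ} (dg : Fin k → ℕ) (π : Equiv.Perm (HE k dg)) (t : ℕ) : ℝ :=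
  ⨆ x, Dx dg π x t

/-- Mixing time. -/
def tmixT {k : ℕ} (dg : Fin k → ℕ) (π : Equiv.Perm (HE k dg)) (ε : ℝ) : ℕ :=
  sInf {t : ℕ | Dmax dg π t < ε}

/-- The finite set of all pairings of the half-edges. -/
def PairingsF {k : ℕ} (dg : Fin k → ℕ) : Finset (Equiv.Perm (HE k dg)) :=
  univ.filter IsPairing

/-- Probability of an event under the uniformly random pairing. -/
def prP {k : ℕ} (dg : Fin k → ℕ) (Q : Equiv.Perm (HE k dg) → Prop) : ℝ :=
  (((PairingsF dg).filter Q).card : ℝ) / ((PairingsF dg).card : ℝ)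

/-- Mean logarithmic degree `μ` of a uniform half-edge. -/
def muD {k : ℕ} (dg : Fin k → ℕ) : ℝ :=
  (Nh dg : ℝ)⁻¹ * ∑ v, (dg v : ℝ) * Real.log ((dg v : ℝ) - 1)

/-- Variance `σ²` of the logarithmic degree of a uniform half-edge. -/
def sigsq {k : ℕ} (dg : Fin k → ℕ) : ℝ :=
  (Nh dg : ℝ)⁻¹ * ∑ v, (dg v : ℝ) * (Real.log ((dg v : ℝ) - 1) - muD dg) ^ 2

/-- Third absolute central moment `ϱ`. -/
def rhoD {k : ℕ} (dg : Fin k → ℕ) : ℝ :=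
  (Nh dg : ℝ)⁻¹ * ∑ v, (dg v : ℝ) * |Real.log ((dg v : ℝ) - 1) - muD dg| ^ 3

/-- Maximum degree `Δ`. -/
def DeltaD {k : ℕ} (dg : Fin k → ℕ) : ℕ := univ.sup dg

/-- The standard normal tail function `Φ`. -/
def Phi (lam : ℝ) : ℝ :=
  (Real.sqrt (2 * Real.pi))⁻¹ * ∫ u in Set.Ioi lam, Real.exp (-u ^ 2 / 2)

/-- Cutoff time `t⋆ = log N / μ`. -/
def tstar {k : ℕ} (dg : Fin k → ℕ) : ℝ := Real.log (Nh dg) / muD dg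

/-- Cutoff window `ω⋆ = √(σ² log N / μ³)`. -/
def wstar {k : ℕ} (dg : Fin k → ℕ) : ℝ :=
  Real.sqrt (sigsq dg * Real.log (Nh dg) / (muD dg) ^ 3)

/-- `P^t_θ(x,y)`: the contribution to `P^t(x,y)` from non-backtracking paths of
weight at most `θ` (a path is recorded as `z : Fin (t+1) → HE` with `z 0 = x`,
`z t = y`, consecutive NBRW steps, and weight `∏_{k=1}^t 1/deg(z_k)`). -/
def Ptrunc {k : ℕ} (dg : Fin k → ℕ) (π : Equiv.Perm (HE k dg)) (t : ℕ) (θ : ℝ)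
    (x y : HE k dg) : ℝ :=
  ∑ z : Fin (t + 1) → HE k dg,
    if z 0 = x ∧ z (Fin.last t) = y ∧
        (∀ i : Fin t, (π (z i.castSucc)).1 = (z i.succ).1 ∧ π (z i.castSucc) ≠ z i.succ) ∧
        (∏ i : Fin t, ((dg (z i.succ).1 : ℝ) - 1)⁻¹) ≤ θ
    then ∏ i : Fin t, ((dg (z i.succ).1 : ℝ) - 1)⁻¹ else 0

/-- Entries of a matrix power as sums over paths. -/
theorem matrix_pow_apply_eq_sum_paths {ι R : Type*} [Fintype ι] [DecidableEq ι] [CommSemiring R]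
    (M : Matrix ι ι R) (t : ℕ) (x y : ι) :
    (M ^ t) x y = ∑ z : Fin (t + 1) → ι,
      if z 0 = x ∧ z (Fin.last t) = y then ∏ i : Fin t, M (z i.castSucc) (z i.succ) else 0 := by
  induction t generalizing x with
  | zero =>
    rw [← (Equiv.funUnique (Fin 1) ι).symm.sum_comp]
    simp [Matrix.one_apply, ite_and]
  | succ t ih =>
    rw [pow_succ', Matrix.mul_apply, ← (Fin.consEquiv fun _ : Fin (t + 2) => ι).sum_comp,
      Fintype.sum_prod_type]
    simp only [ih, Finset.mul_sum, Fin.consEquiv, Equiv.coe_fn_mk, Fin.cons_zero,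
      ← Fin.succ_last, Fin.cons_succ, Fin.prod_univ_succ, Fin.castSucc_zero, ← Fin.succ_castSucc]
    rw [Finset.sum_comm]
    simp [ite_and]

/-- If `p` and `u` both sum to `1`, half their `ℓ¹` distance is the sum of the positive parts of
`u - p`. -/
theorem half_sum_abs_sub_eq_sum_posPart {ι : Type*} [Fintype ι] (p u : ι → ℝ)
    (h : ∑ y, p y = ∑ y, u y) :
    (1 / 2) * ∑ y, |p y - u y| = ∑ y, max (u y - p y) 0 := by
  have key : ∀ y, max (u y - p y) 0 = (1 / 2) * |p y - u y| + (1 / 2) * (u y - p y) := by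
    intro y
    rcases le_total (u y) (p y) with hle | hle
    · rw [max_eq_right (by linarith), abs_of_nonneg (by linarith)]; ring
    · rw [max_eq_left (by linarith), abs_of_nonpos (by linarith)]; ring
  simp only [key, Finset.sum_add_distrib, ← Finset.mul_sum, Finset.sum_sub_distrib, h]
  ring

/-- If `q` agrees with the probability vector `p` except where `p` exceeds `θ`, then the missing
mass of `q` is at most the distance of `p` to uniform plus `1 / (θ N)`. -/
theorem one_sub_sum_le_dist_uniform_add {ι : Type*} [Fintype ι] [Nonempty ι] (p q : ι → ℝ) (θ : ℝ)
    (hθ : 0 < θ) (hp : ∀ y, 0 ≤ p y) (hsum : ∑ y, p y = 1) (hq : ∀ y, 0 ≤ q y)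
    (hpq : ∀ y, q y = p y ∨ θ < p y) :
    1 - ∑ y, q y ≤ (1 / 2) * ∑ y, |p y - (Fintype.card ι : ℝ)⁻¹| +
      (θ * (Fintype.card ι : ℝ))⁻¹ := by
  set N : ℝ := (Fintype.card ι : ℝ) with hN
  have hN0 : 0 < N := by rw [hN]; exact_mod_cast Fintype.card_pos
  have hu : ∑ _y : ι, N⁻¹ = 1 := by
    rw [Finset.sum_const, Finset.card_univ, nsmul_eq_mul, ← hN, mul_inv_cancel₀ hN0.ne']
  rw [half_sum_abs_sub_eq_sum_posPart p (fun _ => N⁻¹) (hsum.trans hu.symm)]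
  have hbound : ∀ y, N⁻¹ - q y ≤ max (N⁻¹ - p y) 0 + (θ * N)⁻¹ * p y := by
    intro y
    rcases hpq y with h | h
    · have := le_max_left (N⁻¹ - p y) 0
      have : 0 ≤ (θ * N)⁻¹ * p y := mul_nonneg (by positivity) (hp y)
      linarith
    · have h1 := le_max_right (N⁻¹ - p y) 0
      have h2 : (θ * N)⁻¹ * θ ≤ (θ * N)⁻¹ * p y :=
        mul_le_mul_of_nonneg_left h.le (by positivity)
      have h3 : (θ * N)⁻¹ * θ = N⁻¹ := by field_simp
      linarith [hq y]
  calc 1 - ∑ y, q y = ∑ y, (N⁻¹ - q y) := by rw [Finset.sum_sub_distrib, hu]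
    _ ≤ ∑ y, (max (N⁻¹ - p y) 0 + (θ * N)⁻¹ * p y) := Finset.sum_le_sum fun y _ => hbound y
    _ = _ := by rw [Finset.sum_add_distrib, ← Finset.mul_sum, hsum, mul_one]

theorem card_HE {k : ℕ} (dg : Fin k → ℕ) : Fintype.card (HE k dg) = Nh dg := by
  simp [HE, Nh]

theorem nbrwP_row_sum {k : ℕ} (dg : Fin k → ℕ) (hdg : ∀ v, 2 ≤ dg v)
    (π : Equiv.Perm (HE k dg)) (x : HE k dg) : ∑ y, nbrwP dg π x y = 1 := by
  unfold nbrwP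
  obtain ⟨v, j⟩ := π x
  have hd : (2 : ℝ) ≤ dg v := by exact_mod_cast hdg v
  dsimp only
  rw [Fintype.sum_sigma, Finset.sum_eq_single v]
  · have hcard : (univ.filter fun i : Fin (dg v) => ¬ j = i).card = dg v - 1 := by
      rw [Finset.filter_not, Finset.card_sdiff]
      simp [Finset.filter_eq]
    simp only [true_and, ne_eq, Sigma.mk.injEq, heq_eq_eq]
    rw [← Finset.sum_filter, Finset.sum_const, nsmul_eq_mul, hcard,
      Nat.cast_sub (by have := hdg v; omega), Nat.cast_one]
    exact mul_inv_cancel₀ (by linarith)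
  · intro w _ hw
    simp [Ne.symm hw]
  · simp

theorem nbrwP_pow_row_sum {k : ℕ} (dg : Fin k → ℕ) (hdg : ∀ v, 2 ≤ dg v)
    (π : Equiv.Perm (HE k dg)) (t : ℕ) (x : HE k dg) : ∑ y, (nbrwP dg π ^ t) x y = 1 := by
  induction t generalizing x with
  | zero => simp [Matrix.one_apply]
  | succ t ih =>
    simp only [pow_succ', Matrix.mul_apply]
    rw [Finset.sum_comm]
    simp only [← Finset.mul_sum, ih, mul_one, nbrwP_row_sum dg hdg]

/-- The probability that the walk follows the path `z` is its weight if `z` is non-backtracking. -/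
theorem prod_nbrwP {k : ℕ} (dg : Fin k → ℕ) (π : Equiv.Perm (HE k dg)) (t : ℕ)
    (z : Fin (t + 1) → HE k dg) :
    ∏ i : Fin t, nbrwP dg π (z i.castSucc) (z i.succ) =
      if ∀ i : Fin t, (π (z i.castSucc)).1 = (z i.succ).1 ∧ π (z i.castSucc) ≠ z i.succ
      then ∏ i : Fin t, ((dg (z i.succ).1 : ℝ) - 1)⁻¹ else 0 := by
  split_ifs with h
  · refine Finset.prod_congr rfl fun i _ => ?_
    rw [nbrwP, if_pos (h i), (h i).1]
  · push Not at h
    obtain ⟨i, hi⟩ := h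
    refine Finset.prod_eq_zero (Finset.mem_univ i) ?_
    rw [nbrwP, if_neg fun hc => hc.2 (hi hc.1)]

/-- The entries of the `t`-step transition matrix as sums of weights of non-backtracking paths. -/
theorem nbrwP_pow_eq_sum_weights {k : ℕ} (dg : Fin k → ℕ) (π : Equiv.Perm (HE k dg)) (t : ℕ)
    (x y : HE k dg) :
    (nbrwP dg π ^ t) x y = ∑ z : Fin (t + 1) → HE k dg,
      if z 0 = x ∧ z (Fin.last t) = y ∧
        (∀ i : Fin t, (π (z i.castSucc)).1 = (z i.succ).1 ∧ π (z i.castSucc) ≠ z i.succ)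
      then ∏ i : Fin t, ((dg (z i.succ).1 : ℝ) - 1)⁻¹ else 0 := by
  rw [matrix_pow_apply_eq_sum_paths]
  refine Finset.sum_congr rfl fun z _ => ?_
  rw [prod_nbrwP]
  split_ifs <;> first | rfl | (exfalso; tauto)

theorem path_weight_nonneg {k : ℕ} (dg : Fin k → ℕ) (hdg : ∀ v, 2 ≤ dg v) (t : ℕ)
    (z : Fin (t + 1) → HE k dg) : 0 ≤ ∏ i : Fin t, ((dg (z i.succ).1 : ℝ) - 1)⁻¹ := by
  refine Finset.prod_nonneg fun i _ => inv_nonneg.mpr ?_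
  have : (2 : ℝ) ≤ dg (z i.succ).1 := by exact_mod_cast hdg _
  linarith

theorem nbrwP_pow_nonneg {k : ℕ} (dg : Fin k → ℕ) (hdg : ∀ v, 2 ≤ dg v)
    (π : Equiv.Perm (HE k dg)) (t : ℕ) (x y : HE k dg) : 0 ≤ (nbrwP dg π ^ t) x y := by
  rw [nbrwP_pow_eq_sum_weights]
  refine Finset.sum_nonneg fun z _ => ?_
  split_ifs
  exacts [path_weight_nonneg dg hdg t z, le_rfl]

theorem Ptrunc_nonneg {k : ℕ} (dg : Fin k → ℕ) (hdg : ∀ v, 2 ≤ dg v)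
    (π : Equiv.Perm (HE k dg)) (t : ℕ) (θ : ℝ) (x y : HE k dg) : 0 ≤ Ptrunc dg π t θ x y := by
  refine Finset.sum_nonneg fun z _ => ?_
  split_ifs
  exacts [path_weight_nonneg dg hdg t z, le_rfl]

/-- Truncation changes the `(x, y)` entry only if that entry exceeds the truncation level. -/
theorem Ptrunc_eq_or_lt {k : ℕ} (dg : Fin k → ℕ) (hdg : ∀ v, 2 ≤ dg v)
    (π : Equiv.Perm (HE k dg)) (t : ℕ) (θ : ℝ) (x y : HE k dg) :
    Ptrunc dg π t θ x y = (nbrwP dg π ^ t) x y ∨ θ < (nbrwP dg π ^ t) x y := by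
  refine or_iff_not_imp_right.mpr fun hle => ?_
  rw [not_lt] at hle
  rw [nbrwP_pow_eq_sum_weights] at hle ⊢
  refine Finset.sum_congr rfl fun z _ => ?_
  have hz := (Finset.single_le_sum (fun w _ => by
    split_ifs
    exacts [path_weight_nonneg dg hdg t w, le_rfl]) (Finset.mem_univ z)).trans hle
  split_ifs at hz ⊢ <;> first | rfl | (exfalso; tauto)

/-- **Truncated-weight lower bound on the distance to stationarity**: for any
pairing `π`, any `x`, any `t ≥ 1` and `θ ∈ (0,1)`,
`1 - Σ_y P^t_θ(x,y) ≤ 𝒟_x(t) + 1/(θ N)`. -/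
theorem truncated_lower_bound {k : ℕ} (hk : 0 < k) (dg : Fin k → ℕ)
    (hdg : ∀ v, 2 ≤ dg v) (π : Equiv.Perm (HE k dg)) (hπ : IsPairing π)
    (x : HE k dg) (t : ℕ) (ht : 1 ≤ t) (θ : ℝ) (hθ0 : 0 < θ) (hθ1 : θ < 1) :
    1 - ∑ y, Ptrunc dg π t θ x y ≤ Dx dg π x t + (θ * (Nh dg : ℝ))⁻¹ := by
  have hN : (Nh dg : ℝ) = Fintype.card (HE k dg) := by rw [card_HE]
  have : Nonempty (HE k dg) := ⟨x⟩
  rw [Dx, hN]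
  exact one_sub_sum_le_dist_uniform_add _ _ θ hθ0 (nbrwP_pow_nonneg dg hdg π t x)
    (nbrwP_pow_row_sum dg hdg π t x) (Ptrunc_nonneg dg hdg π t θ x)
    (Ptrunc_eq_or_lt dg hdg π t θ x)

end
end

section
/- Deterministic root-reaching bound: let π be a pairing of X such that min_v deg(v) ≥ 3 and no ball of radius r in G(π) contains more than one cycle, and let h ≤ r. Then the NBRW on G(π) started from any x ∈ X satisfies P(X_t is not a root) ≤ 2^{1−t} for every 1 ≤ t ≤ r − h, where a half-edge z is a root if the ball of radius h around z in G(π) is a tree. -/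
open Classical Filter Finset

noncomputable section

/-- `IsNBPath π p`: the list `p` of half-edges is a non-backtracking path,
each element being a neighbour of the image under `π` of the previous one. -/
def IsNBPath {k : ℕ} {dg : Fin k → ℕ} (π : Equiv.Perm (HE k dg)) :
    List (HE k dg) → Prop
  | [] => True
  | [_] => True
  | x :: y :: r => ((π x).1 = y.1 ∧ π x ≠ y) ∧ IsNBPath π (y :: r)

/-- `x` is a root: the ball of radius `h` around `x` is a tree, i.e. every half-edge
reachable in at most `h` non-backtracking steps from `x` is reached by a unique
non-backtracking path. -/
def IsRoot {k : ℕ} (dg : Fin k → ℕ) (π : Equiv.Perm (HE k dg)) (h : ℕ)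
    (x : HE k dg) : Prop :=
  ∀ p q : List (HE k dg), IsNBPath π p → IsNBPath π q →
    p.head? = some x → q.head? = some x →
    p.length ≤ h + 1 → q.length ≤ h + 1 →
    p.getLast? = q.getLast? → p = q

/-- `y` belongs to the ball of radius `h` around `x` (reachable in `≤ h` NBRW steps). -/
def InBall {k : ℕ} (dg : Fin k → ℕ) (π : Equiv.Perm (HE k dg)) (h : ℕ)
    (x y : HE k dg) : Prop :=
  ∃ s ≤ h, ((nbrwP dg π) ^ s) x y ≠ 0

/-- The radius `h = ⌊min(log N / (10 log Δ), log log N)⌋`. -/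
def hrad {k : ℕ} (dg : Fin k → ℕ) : ℕ :=
  ⌊min (Real.log (Nh dg) / (10 * Real.log (DeltaD dg)))
      (Real.log (Real.log (Nh dg)))⌋₊
/-- Adjacency of vertices in the multigraph `G(π)`. -/
def AdjV {k : ℕ} (dg : Fin k → ℕ) (π : Equiv.Perm (HE k dg)) (u w : Fin k) : Prop :=
  ∃ z : HE k dg, z.1 = u ∧ (π z).1 = w

/-- `w` is within graph distance `r` of `u` in `G(π)`. -/
def WithinDist {k : ℕ} (dg : Fin k → ℕ) (π : Equiv.Perm (HE k dg)) (r : ℕ)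
    (u w : Fin k) : Prop :=
  ∃ s ≤ r, ∃ f : Fin (s + 1) → Fin k, f 0 = u ∧ f (Fin.last s) = w ∧
    ∀ i : Fin s, AdjV dg π (f i.castSucc) (f i.succ)

/-- Vertices of the ball of radius `r` around the half-edge `x`. -/
def ballVerts {k : ℕ} (dg : Fin k → ℕ) (π : Equiv.Perm (HE k dg)) (r : ℕ)
    (x : HE k dg) : Finset (Fin k) :=
  univ.filter fun w => WithinDist dg π r x.1 w

/-- Half-edges spanning the edges of the ball of radius `r` around `x`: a pair
`{z, π z}` is an edge of the ball when both endpoints lie in it, so the ball has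
more edges than vertices iff `2 * (ballVerts).card < (ballHEs).card`. -/
def ballHEs {k : ℕ} (dg : Fin k → ℕ) (π : Equiv.Perm (HE k dg)) (r : ℕ)
    (x : HE k dg) : Finset (HE k dg) :=
  univ.filter fun z => WithinDist dg π r x.1 z.1 ∧ WithinDist dg π r x.1 (π z).1

section Walks

variable {k : ℕ} {dg : Fin k → ℕ} {π : Equiv.Perm (HE k dg)}

/-- A single non-backtracking step from `x` to `y`. -/
def NBStep (π : Equiv.Perm (HE k dg)) (x y : HE k dg) : Prop :=
  (π x).1 = y.1 ∧ π x ≠ y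

theorem isNBPath_iff_isChain (p : List (HE k dg)) :
    IsNBPath π p ↔ p.IsChain (NBStep π) := by
  induction p with
  | nil => simp [IsNBPath]
  | cons x p ih =>
    cases p with
    | nil => simp [IsNBPath]
    | cons y r => simp only [IsNBPath, List.isChain_cons_cons, ih]; rfl

/-- `Up` selects the half-edges of a forest that point towards the parent: at most one at each
vertex, and `d` decreases along it. -/
structure IsForest (π : Equiv.Perm (HE k dg)) (d : Fin k → ℕ) (Up : HE k dg → Prop) : Prop where
  unique : ∀ z z', Up z → Up z' → z.1 = z'.1 → z = z'
  depth_lt : ∀ z, Up z → d (π z).1 < d z.1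

/-- The first `n` half-edges of `W` are crossed by non-backtracking steps along forest edges. -/
structure IsForestWalk (π : Equiv.Perm (HE k dg)) (Up : HE k dg → Prop) (W : ℕ → HE k dg)
    (n : ℕ) : Prop where
  step : ∀ i < n, NBStep π (W i) (W (i + 1))
  mem : ∀ i < n, Up (W i) ∨ Up (π (W i))

variable {d : Fin k → ℕ} {Up : HE k dg → Prop}

theorem IsForestWalk.shift {W : ℕ → HE k dg} {n : ℕ} (hW : IsForestWalk π Up W (n + 1)) :
    IsForestWalk π Up (fun i => W (i + 1)) n :=
  ⟨fun i hi => hW.step (i + 1) (by omega), fun i hi => hW.mem (i + 1) (by omega)⟩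

theorem IsForestWalk.dropLast {W : ℕ → HE k dg} {n : ℕ} (hW : IsForestWalk π Up W (n + 1)) :
    IsForestWalk π Up W n :=
  ⟨fun i hi => hW.step i (by omega), fun i hi => hW.mem i (by omega)⟩

/-- A non-backtracking step cannot go up the forest right after going down. -/
theorem IsForest.not_up_of_down (hF : IsForest π d Up) {x y : HE k dg} (hs : NBStep π x y)
    (hx : Up (π x)) : ¬ Up y :=
  fun hy => hs.2 (hF.unique _ _ hx hy hs.1)

theorem IsForestWalk.depth_lt_of_last_up (hF : IsForest π d Up) {W : ℕ → HE k dg} {n : ℕ}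
    (hW : IsForestWalk π Up W (n + 1)) (hn : Up (W n)) : d (W (n + 1)).1 < d (W 0).1 := by
  induction n with
  | zero =>
    rw [← (hW.step 0 (by omega)).1]
    exact hF.depth_lt _ hn
  | succ n ih =>
    have hup : Up (W n) := (hW.mem n (by omega)).resolve_right
      fun h => hF.not_up_of_down (hW.step n (by omega)) h hn
    have h1 := ih hW.dropLast hup
    have h2 := hF.depth_lt _ hn
    rw [(hW.step (n + 1) (by omega)).1] at h2
    omega

theorem IsForestWalk.depth_lt_of_first_down (hπ : IsPairing π) (hF : IsForest π d Up)
    {W : ℕ → HE k dg} {n : ℕ} (hW : IsForestWalk π Up W (n + 1)) (h0 : Up (π (W 0))) :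
    d (W 0).1 < d (W (n + 1)).1 := by
  induction n generalizing W with
  | zero =>
    have h := hF.depth_lt _ h0
    rwa [hπ.1, (hW.step 0 (by omega)).1] at h
  | succ n ih =>
    have hdown : Up (π (W 1)) := (hW.mem 1 (by omega)).resolve_left
      (hF.not_up_of_down (hW.step 0 (by omega)) h0)
    have h1 := ih hW.shift hdown
    have h2 := hF.depth_lt _ h0
    rw [hπ.1, (hW.step 0 (by omega)).1] at h2
    simp only [zero_add] at h1 h2
    omega

/-- Closed non-backtracking walks in a forest are trivial. -/
theorem IsForestWalk.length_eq_zero (hπ : IsPairing π) (hF : IsForest π d Up)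
    {W : ℕ → HE k dg} {n : ℕ} (hW : IsForestWalk π Up W n) (hc : (W 0).1 = (W n).1) :
    n = 0 := by
  induction n using Nat.strong_induction_on generalizing W with
  | _ n ih =>
    rcases n with _ | n
    · rfl
    exfalso
    have hup : Up (W 0) := (hW.mem 0 (by omega)).resolve_right fun h => by
      have := hW.depth_lt_of_first_down hπ hF h
      rw [hc] at this
      omega
    have hdown : Up (π (W n)) := (hW.mem n (by omega)).resolve_left fun h => by
      have := hW.depth_lt_of_last_up hF h
      rw [hc] at this
      omega
    have hlast := (hW.step n (by omega)).1
    have heq : π (W n) = W 0 := hF.unique _ _ hdown hup (hlast.trans hc.symm)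
    rcases n with _ | n
    · exact hπ.2 _ heq
    have heq' : π (W 0) = W (n + 1) := by rw [← heq, hπ.1]
    have hs := hW.step 0 (by omega)
    have hn := ih n (by omega) hW.dropLast.shift (by
      change (W 1).1 = (W (n + 1)).1
      rw [← heq', hs.1])
    subst hn
    exact hs.2 heq'

/-- Non-backtracking walks in a forest are determined by their end points. -/
theorem IsForestWalk.unique (hπ : IsPairing π) (hF : IsForest π d Up) {W W' : ℕ → HE k dg}
    {n n' : ℕ} (hW : IsForestWalk π Up W n) (hW' : IsForestWalk π Up W' n')
    (h0 : (W 0).1 = (W' 0).1) (hn : (W n).1 = (W' n').1) :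
    n = n' ∧ ∀ i < n, W i = W' i := by
  induction n generalizing W W' n' with
  | zero =>
    have := hW'.length_eq_zero hπ hF (h0.symm.trans hn)
    exact ⟨this.symm, fun i hi => by omega⟩
  | succ n ih =>
    rcases n' with _ | n'
    · exact absurd (hW.length_eq_zero hπ hF (h0.trans hn.symm)) (by omega)
    by_cases hup : Up (W 0) ∧ Up (W' 0)
    · have he : W 0 = W' 0 := hF.unique _ _ hup.1 hup.2 h0
      have h1 : (W 1).1 = (W' 1).1 := by
        rw [← (hW.step 0 (by omega)).1, ← (hW'.step 0 (by omega)).1, he]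
      obtain ⟨e, hi⟩ := ih hW.shift hW'.shift h1 hn
      refine ⟨by omega, fun i hin => ?_⟩
      rcases i with _ | i
      · exact he
      · exact hi i (by omega)
    by_cases hdown : Up (π (W n)) ∧ Up (π (W' n'))
    · have he : W n = W' n' := π.injective (hF.unique _ _ hdown.1 hdown.2 (by
        rw [(hW.step n (by omega)).1, (hW'.step n' (by omega)).1, hn]))
      obtain ⟨e, hi⟩ := ih hW.dropLast hW'.dropLast h0 (by rw [he])
      refine ⟨by omega, fun i hin => ?_⟩
      rcases Nat.lt_succ_iff_lt_or_eq.1 hin with h | h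
      · exact hi i h
      · rw [h, he, e]
    exfalso
    have hlt : d (W 0).1 < d (W (n + 1)).1 := by
      by_cases h : Up (W 0)
      · rw [h0, hn]
        exact hW'.depth_lt_of_first_down hπ hF
          ((hW'.mem 0 (by omega)).resolve_left fun h' => hup ⟨h, h'⟩)
      · exact hW.depth_lt_of_first_down hπ hF ((hW.mem 0 (by omega)).resolve_left h)
    have hgt : d (W (n + 1)).1 < d (W 0).1 := by
      by_cases h : Up (π (W n))
      · rw [h0, hn]
        exact hW'.depth_lt_of_last_up hF
          ((hW'.mem n' (by omega)).resolve_right fun h' => hdown ⟨h, h'⟩)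
      · exact hW.depth_lt_of_last_up hF ((hW.mem n (by omega)).resolve_right h)
    omega

/-- The walk `W` makes `n` non-backtracking steps, each crossing a forest edge or the extra edge
`{a, π a}`. -/
structure IsUnicyclicWalk (π : Equiv.Perm (HE k dg)) (Up : HE k dg → Prop) (a : HE k dg)
    (W : ℕ → HE k dg) (n : ℕ) : Prop where
  step : ∀ i < n, NBStep π (W i) (W (i + 1))
  mem : ∀ i < n, Up (W i) ∨ Up (π (W i)) ∨ W i = a ∨ W i = π a

variable {a : HE k dg}

theorem IsUnicyclicWalk.drop {W : ℕ → HE k dg} {n m j : ℕ} (hW : IsUnicyclicWalk π Up a W n)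
    (h : j + m ≤ n) : IsUnicyclicWalk π Up a (fun i => W (j + i)) m :=
  ⟨fun i hi => hW.step (j + i) (by omega), fun i hi => hW.mem (j + i) (by omega)⟩

theorem IsUnicyclicWalk.mono {W : ℕ → HE k dg} {n m : ℕ} (hW : IsUnicyclicWalk π Up a W n)
    (h : m ≤ n) : IsUnicyclicWalk π Up a W m :=
  ⟨fun i hi => hW.step i (by omega), fun i hi => hW.mem i (by omega)⟩

theorem IsUnicyclicWalk.isForestWalk {W : ℕ → HE k dg} {n : ℕ}
    (hW : IsUnicyclicWalk π Up a W n) (ha : ∀ i < n, ¬ (W i = a ∨ W i = π a)) :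
    IsForestWalk π Up W n :=
  ⟨hW.step, fun i hi => by
    have h1 := hW.mem i hi
    have h2 := ha i hi
    tauto⟩

/-- A non-backtracking walk always crosses the extra edge in the same direction. -/
theorem IsUnicyclicWalk.extra_eq (hπ : IsPairing π) (hF : IsForest π d Up) {W : ℕ → HE k dg}
    {n : ℕ} (hW : IsUnicyclicWalk π Up a W n) (h0 : W 0 = a ∨ W 0 = π a)
    (hn : W n = a ∨ W n = π a) : W n = W 0 := by
  induction n using Nat.strong_induction_on generalizing W with
  | _ n ih =>
    by_cases hmid : ∃ j, 0 < j ∧ j < n ∧ (W j = a ∨ W j = π a)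
    · obtain ⟨j, hj0, hjn, hj⟩ := hmid
      have h1 := ih j hjn (hW.mono hjn.le) h0 hj
      have h2 := ih (n - j) (by omega) (hW.drop (j := j) (m := n - j) (by omega))
        (by simpa using hj) (by simpa [Nat.add_sub_cancel' hjn.le] using hn)
      simp only [Nat.add_sub_cancel' hjn.le, add_zero] at h2
      rw [h2, h1]
    by_contra hne
    rcases n with _ | n
    · exact hne rfl
    have hflip : W (n + 1) = π (W 0) := by
      rcases h0 with h0 | h0 <;> rcases hn with hn | hn <;> simp_all [hπ.1]
    have hfw := (hW.drop (j := 1) (m := n) (by omega)).isForestWalk (fun i hi h =>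
      hmid ⟨1 + i, by omega, by omega, h⟩)
    have hs := hW.step 0 (by omega)
    have hn0 := hfw.length_eq_zero hπ hF (by
      rw [add_comm 1 n, hflip, hs.1])
    subst hn0
    exact hs.2 hflip.symm

/-- Two non-backtracking walks from the same vertex that end by reaching the extra edge in the
same direction coincide. -/
theorem IsUnicyclicWalk.eq_of_extra (hπ : IsPairing π) (hF : IsForest π d Up)
    {W W' : ℕ → HE k dg} {m m' : ℕ} (hW : IsUnicyclicWalk π Up a W m)
    (hW' : IsUnicyclicWalk π Up a W' m') (h0 : (W 0).1 = (W' 0).1) (hm : W m = a ∨ W m = π a)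
    (hmm : W m = W' m') (i : ℕ) (hi : i ≤ m) (hi' : i ≤ m') : W i = W' i := by
  induction m using Nat.strong_induction_on generalizing W W' m' i with
  | _ m ih =>
    have hex : ∃ j, W j = a ∨ W j = π a := ⟨m, hm⟩
    have hm' : W' m' = a ∨ W' m' = π a := hmm ▸ hm
    have hex' : ∃ j, W' j = a ∨ W' j = π a := ⟨m', hm'⟩
    obtain ⟨f, hf, hfmin⟩ : ∃ f, (W f = a ∨ W f = π a) ∧ ∀ j < f, ¬ (W j = a ∨ W j = π a) :=
      ⟨Nat.find hex, Nat.find_spec hex, fun j hj => Nat.find_min hex hj⟩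
    obtain ⟨f', hf', hfmin'⟩ :
        ∃ f, (W' f = a ∨ W' f = π a) ∧ ∀ j < f, ¬ (W' j = a ∨ W' j = π a) :=
      ⟨Nat.find hex', Nat.find_spec hex', fun j hj => Nat.find_min hex' hj⟩
    have hfm : f ≤ m := by
      by_contra h
      exact hfmin m (by omega) hm
    have hfm' : f' ≤ m' := by
      by_contra h
      exact hfmin' m' (by omega) hm'
    have e := (hW.drop (j := f) (m := m - f) (by omega)).extra_eq hπ hF (by simpa using hf)
      (by simpa [Nat.add_sub_cancel' hfm] using hm)
    have e' := (hW'.drop (j := f') (m := m' - f') (by omega)).extra_eq hπ hF (by simpa using hf')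
      (by simpa [Nat.add_sub_cancel' hfm'] using hm')
    simp only [Nat.add_sub_cancel' hfm, Nat.add_sub_cancel' hfm', add_zero] at e e'
    have hff : W f = W' f' := by rw [← e, ← e', hmm]
    obtain ⟨hlen, hag⟩ := ((hW.mono hfm).isForestWalk hfmin).unique hπ hF
      ((hW'.mono hfm').isForestWalk hfmin') h0 (by rw [hff])
    subst hlen
    rcases lt_trichotomy i f with h | h | h
    · exact hag i h
    · rw [h, hff]
    have key := ih (m - (f + 1)) (by omega)
      (hW.drop (j := f + 1) (m := m - (f + 1)) (by omega))
      (hW'.drop (j := f + 1) (m := m' - (f + 1)) (by omega))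
      (by
        change (W (f + 1)).1 = (W' (f + 1)).1
        rw [← (hW.step f (by omega)).1, ← (hW'.step f (by omega)).1, hff])
      (by simpa only [Nat.add_sub_cancel' (show f + 1 ≤ m by omega)] using hm)
      (by simpa only [Nat.add_sub_cancel' (show f + 1 ≤ m by omega),
            Nat.add_sub_cancel' (show f + 1 ≤ m' by omega)] using hmm)
      (i - (f + 1)) (by omega) (by omega)
    simpa only [Nat.add_sub_cancel' (show f + 1 ≤ i by omega)] using key

end Walks

section Ball

variable {k : ℕ} {dg : Fin k → ℕ} {π : Equiv.Perm (HE k dg)}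

theorem withinDist_refl (r : ℕ) (u : Fin k) : WithinDist dg π r u u :=
  ⟨0, Nat.zero_le _, fun _ => u, rfl, rfl, fun i => i.elim0⟩

theorem WithinDist.mono {r r' : ℕ} {u w : Fin k} (h : WithinDist dg π r u w) (hr : r ≤ r') :
    WithinDist dg π r' u w := by
  obtain ⟨s, hs, f, hf⟩ := h
  exact ⟨s, hs.trans hr, f, hf⟩

theorem WithinDist.succ {r : ℕ} {u v w : Fin k} (h : WithinDist dg π r u v)
    (hvw : AdjV dg π v w) : WithinDist dg π (r + 1) u w := by
  obtain ⟨s, hs, f, h0, hl, hf⟩ := h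
  refine ⟨s + 1, by omega, Fin.snoc f w, ?_, by simp, fun i => ?_⟩
  · rw [← Fin.castSucc_zero, Fin.snoc_castSucc, h0]
  · refine Fin.lastCases ?_ (fun j => ?_) i
    · rw [Fin.snoc_castSucc, hl, Fin.succ_last, Fin.snoc_last]
      exact hvw
    · rw [Fin.snoc_castSucc, Fin.succ_castSucc, Fin.snoc_castSucc]
      exact hf j

theorem WithinDist.eq_or_exists_pred {r : ℕ} {u w : Fin k} (h : WithinDist dg π r u w) :
    w = u ∨ ∃ r' < r, ∃ v, WithinDist dg π r' u v ∧ AdjV dg π v w := by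
  obtain ⟨s, hs, f, h0, hl, hf⟩ := h
  rcases s with _ | s
  · left
    rw [← h0, ← hl]
    rfl
  · right
    refine ⟨s, by omega, f (Fin.last s).castSucc,
      ⟨s, le_rfl, fun i => f i.castSucc, by simpa using h0, rfl, fun i => ?_⟩, ?_⟩
    · have := hf i.castSucc
      rwa [Fin.succ_castSucc] at this
    · rw [← hl, ← Fin.succ_last]
      exact hf (Fin.last s)

/-- A ball with at most one cycle is covered by a breadth-first forest and one extra edge. -/
theorem exists_isForest_extra (hπ : IsPairing π) (r : ℕ) (x : HE k dg)
    (hball : (ballHEs dg π r x).card ≤ 2 * (ballVerts dg π r x).card) :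
    ∃ (d : Fin k → ℕ) (Up : HE k dg → Prop) (a : HE k dg), IsForest π d Up ∧
      ∀ z ∈ ballHEs dg π r x, Up z ∨ Up (π z) ∨ z = a ∨ z = π a := by
  let d : Fin k → ℕ := fun v => sInf {s | WithinDist dg π s x.1 v}
  have hpar : ∀ v, ∃ z : HE k dg, v ∈ (ballVerts dg π r x).erase x.1 →
      z.1 = v ∧ d (π z).1 < d v ∧ z ∈ ballHEs dg π r x := by
    intro v
    by_cases hv : v ∈ (ballVerts dg π r x).erase x.1
    · obtain ⟨hne, hvb⟩ := Finset.mem_erase.1 hv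
      have hvr : WithinDist dg π r x.1 v := (Finset.mem_filter.1 hvb).2
      have hd : WithinDist dg π (d v) x.1 v :=
        Nat.sInf_mem (s := {s | WithinDist dg π s x.1 v}) ⟨r, hvr⟩
      have hdr : d v ≤ r := Nat.sInf_le hvr
      obtain ⟨r', hr', w, hw, z, hz, hzv⟩ := hd.eq_or_exists_pred.resolve_left hne
      refine ⟨π z, fun _ => ⟨hzv, ?_, ?_⟩⟩
      · rw [hπ.1, hz]
        exact lt_of_le_of_lt (Nat.sInf_le hw) hr'
      · simp only [ballHEs, Finset.mem_filter, Finset.mem_univ, true_and, hπ.1, hz, hzv]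
        exact ⟨hvr, hw.mono (by omega)⟩
    · exact ⟨x, fun h => absurd h hv⟩
  choose par hpar using hpar
  let U : Finset (HE k dg) := ((ballVerts dg π r x).erase x.1).image par
  have hU : ∀ z ∈ U, z.1 ∈ (ballVerts dg π r x).erase x.1 ∧ z = par z.1 := by
    intro z hz
    obtain ⟨v, hv, rfl⟩ := Finset.mem_image.1 hz
    rw [(hpar v hv).1]
    exact ⟨hv, rfl⟩
  have hF : IsForest π d (· ∈ U) := by
    refine ⟨fun z z' hz hz' h => ?_, fun z hz => ?_⟩
    · rw [(hU z hz).2, (hU z' hz').2, h]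
    · obtain ⟨v, hv, rfl⟩ := Finset.mem_image.1 hz
      rw [(hpar v hv).1]
      exact (hpar v hv).2.1
  have hπball : ∀ z ∈ ballHEs dg π r x, π z ∈ ballHEs dg π r x := by
    intro z hz
    simp only [ballHEs, Finset.mem_filter, Finset.mem_univ, true_and, hπ.1] at hz ⊢
    exact hz.symm
  have hUball : U ⊆ ballHEs dg π r x := by
    intro z hz
    obtain ⟨v, hv, rfl⟩ := Finset.mem_image.1 hz
    exact (hpar v hv).2.2
  have hDball : U.image π ⊆ ballHEs dg π r x := by
    intro z hz
    obtain ⟨v, hv, rfl⟩ := Finset.mem_image.1 hz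
    exact hπball v (hUball hv)
  have hdisj : Disjoint U (U.image π) := by
    rw [Finset.disjoint_left]
    intro z hz hz'
    obtain ⟨v, hv, rfl⟩ := Finset.mem_image.1 hz'
    have h1 := hF.depth_lt _ hz
    have h2 := hF.depth_lt _ hv
    rw [hπ.1] at h1
    omega
  have hxb : x.1 ∈ ballVerts dg π r x :=
    Finset.mem_filter.2 ⟨Finset.mem_univ _, withinDist_refl r x.1⟩
  have hUcard : U.card + 1 = (ballVerts dg π r x).card := by
    rw [Finset.card_image_of_injOn, Finset.card_erase_add_one hxb]
    intro v hv w hw h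
    rw [← (hpar v hv).1, ← (hpar w hw).1]
    exact congrArg Sigma.fst h
  have hDcard : (U.image π).card = U.card := Finset.card_image_of_injective _ π.injective
  let R := ballHEs dg π r x \ (U ∪ U.image π)
  have hR : R.card ≤ 2 := by
    have := Finset.card_sdiff_add_card_eq_card (Finset.union_subset hUball hDball)
    rw [Finset.card_union_of_disjoint hdisj] at this
    change R.card + _ = _ at this
    omega
  have hmemD : ∀ z, z ∈ U.image π ↔ π z ∈ U := fun z =>
    ⟨fun h => by
      obtain ⟨v, hv, rfl⟩ := Finset.mem_image.1 h
      rwa [hπ.1], fun h => Finset.mem_image.2 ⟨π z, h, hπ.1 z⟩⟩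
  have hmemR : ∀ z, z ∈ R ↔ z ∈ ballHEs dg π r x ∧ z ∉ U ∧ π z ∉ U := fun z => by
    simp only [R, Finset.mem_sdiff, Finset.mem_union, hmemD, not_or]
  by_cases hne : R.Nonempty
  · obtain ⟨a, ha⟩ := hne
    refine ⟨d, (· ∈ U), a, hF, fun z hz => ?_⟩
    by_contra hcon
    simp only [not_or] at hcon
    have hzR : z ∈ R := (hmemR z).2 ⟨hz, hcon.1, hcon.2.1⟩
    have ha' := (hmemR a).1 ha
    have haR : π a ∈ R := (hmemR _).2 ⟨hπball a ha'.1, ha'.2.2, by rw [hπ.1]; exact ha'.2.1⟩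
    have hsub : ({z, a, π a} : Finset (HE k dg)) ⊆ R := by
      intro y hy
      simp only [Finset.mem_insert, Finset.mem_singleton] at hy
      rcases hy with rfl | rfl | rfl <;> assumption
    have h3 : ({z, a, π a} : Finset (HE k dg)).card = 3 :=
      Finset.card_eq_three.2 ⟨z, a, π a, hcon.2.2.1, hcon.2.2.2, (hπ.2 a).symm, rfl⟩
    have := Finset.card_le_card hsub
    omega
  · refine ⟨d, (· ∈ U), x, hF, fun z hz => ?_⟩
    by_contra hcon
    simp only [not_or] at hcon
    exact hne ⟨z, (hmemR z).2 ⟨hz, hcon.1, hcon.2.1⟩⟩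

theorem withinDist_of_steps {W : ℕ → HE k dg} {n : ℕ}
    (hW : ∀ i < n, NBStep π (W i) (W (i + 1))) (i : ℕ) (hi : i ≤ n) :
    WithinDist dg π i (W 0).1 (W i).1 := by
  induction i with
  | zero => exact withinDist_refl _ _
  | succ i ih => exact (ih (by omega)).succ ⟨W i, rfl, (hW i (by omega)).1⟩

theorem mem_ballHEs_of_steps {W : ℕ → HE k dg} {n r : ℕ} (hnr : n ≤ r)
    (hW : ∀ i < n, NBStep π (W i) (W (i + 1))) (i : ℕ) (hi : i < n) :
    W i ∈ ballHEs dg π r (W 0) := by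
  refine Finset.mem_filter.2 ⟨Finset.mem_univ _, ?_, ?_⟩
  · exact (withinDist_of_steps hW i hi.le).mono (by omega)
  · rw [(hW i hi).1]
    exact (withinDist_of_steps hW (i + 1) hi).mono (by omega)

end Ball

section Counting

variable {k : ℕ} {dg : Fin k → ℕ} {π : Equiv.Perm (HE k dg)}

/-- If all degrees are at least `3`, every `t`-step non-backtracking path has probability at most
`2⁻ᵗ`. -/
theorem exists_paths_sum_pow_le (hdg : ∀ v, 3 ≤ dg v) (A : Finset (HE k dg)) (t : ℕ)
    (x : HE k dg) :
    ∃ S : Finset (List (HE k dg)),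
      (∀ p ∈ S, p.length = t + 1 ∧ p.head? = some x ∧ p.IsChain (NBStep π) ∧
        ∃ y ∈ A, p.getLast? = some y) ∧
      ∑ y ∈ A, ((nbrwP dg π) ^ t) x y ≤ (1 / 2 : ℝ) ^ t * S.card := by
  induction t generalizing x with
  | zero =>
    by_cases hx : x ∈ A
    · refine ⟨{[x]}, fun p hp => ?_, ?_⟩
      · obtain rfl := Finset.mem_singleton.1 hp
        exact ⟨rfl, rfl, List.isChain_singleton x, x, hx, rfl⟩
      · simp [Matrix.one_apply, hx]
    · refine ⟨∅, by simp, ?_⟩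
      simp [Matrix.one_apply, hx]
  | succ t ih =>
    choose S hS hle using ih
    let nb : Finset (HE k dg) := univ.filter (NBStep π x)
    refine ⟨nb.biUnion fun z => (S z).image (List.cons x), ?_, ?_⟩
    · intro p hp
      obtain ⟨z, hz, hp⟩ := Finset.mem_biUnion.1 hp
      obtain ⟨q, hq, rfl⟩ := Finset.mem_image.1 hp
      obtain ⟨h1, h2, h3, y, hy, h4⟩ := hS z q hq
      obtain ⟨q', rfl⟩ : ∃ q', q = z :: q' := by
        cases q with
        | nil => simp at h2
        | cons w q' => exact ⟨q', by simpa using h2⟩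
      refine ⟨by simpa using h1, rfl, ?_, y, hy, ?_⟩
      · exact List.isChain_cons_cons.2 ⟨(Finset.mem_filter.1 hz).2, h3⟩
      · rw [List.getLast?_cons_cons, h4]
    · have hcard : (nb.biUnion fun z => (S z).image (List.cons x)).card
          = ∑ z ∈ nb, (S z).card := by
        rw [Finset.card_biUnion]
        · exact Finset.sum_congr rfl fun z _ =>
            Finset.card_image_of_injective _ List.cons_injective
        · intro z _ w _ hzw
          rw [Function.onFun, Finset.disjoint_left]
          intro p hp hp'
          obtain ⟨q, hq, rfl⟩ := Finset.mem_image.1 hp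
          obtain ⟨q', hq', he⟩ := Finset.mem_image.1 hp'
          obtain rfl := List.cons_injective he
          have h := (hS z _ hq).2.1
          rw [(hS w _ hq').2.1] at h
          exact hzw (Option.some_injective _ h).symm
      rw [hcard]
      have hpow : ∑ y ∈ A, ((nbrwP dg π) ^ (t + 1)) x y
          = ∑ z, nbrwP dg π x z * ∑ y ∈ A, ((nbrwP dg π) ^ t) z y := by
        simp only [pow_succ', Matrix.mul_apply, Finset.mul_sum]
        exact Finset.sum_comm
      rw [hpow, Nat.cast_sum, Finset.mul_sum, Finset.sum_filter]
      refine Finset.sum_le_sum fun z _ => ?_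
      by_cases hz : NBStep π x z
      · rw [if_pos hz]
        have h3 : (3 : ℝ) ≤ dg (π x).1 := by exact_mod_cast hdg _
        have hw : nbrwP dg π x z = ((dg (π x).1 : ℝ) - 1)⁻¹ := if_pos hz
        have hw0 : 0 ≤ nbrwP dg π x z := by
          rw [hw]
          exact inv_nonneg.2 (by linarith)
        have hw2 : nbrwP dg π x z ≤ 1 / 2 := by
          rw [hw, one_div]
          exact inv_anti₀ (by norm_num) (by linarith)
        calc _ ≤ nbrwP dg π x z * ((1 / 2 : ℝ) ^ t * (S z).card) :=
              mul_le_mul_of_nonneg_left (hle z) hw0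
          _ ≤ 1 / 2 * ((1 / 2 : ℝ) ^ t * (S z).card) :=
              mul_le_mul_of_nonneg_right hw2 (by positivity)
          _ = _ := by ring
      · rw [if_neg hz]
        have hw : nbrwP dg π x z = 0 := if_neg hz
        rw [hw, zero_mul]

end Counting

section Roots

variable {k : ℕ} {dg : Fin k → ℕ} {π : Equiv.Perm (HE k dg)}

theorem isChain_getD_step {p : List (HE k dg)} (hp : p.IsChain (NBStep π)) (x : HE k dg)
    (i : ℕ) (hi : i < p.length - 1) : NBStep π (p.getD i x) (p.getD (i + 1) x) := by
  rw [List.getD_eq_getElem _ _ (by omega), List.getD_eq_getElem _ _ (by omega)]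
  exact List.isChain_iff_getElem.1 hp i (by omega)

/-- If a non-backtracking path of `t` steps from `x` ends at a half-edge which is not a root, it
extends to one which crosses the extra edge at time at least `t`. -/
theorem exists_extension_extra (hπ : IsPairing π) {d : Fin k → ℕ} {Up : HE k dg → Prop}
    {a : HE k dg} (hF : IsForest π d Up) {r h t : ℕ} (hth : t + h ≤ r) {x : HE k dg}
    (hcov : ∀ z ∈ ballHEs dg π r x, Up z ∨ Up (π z) ∨ z = a ∨ z = π a)
    {P : List (HE k dg)} (hP : P.IsChain (NBStep π)) (hlen : P.length = t + 1)
    (hhead : P.head? = some x) {y : HE k dg} (hlast : P.getLast? = some y)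
    (hy : ¬ IsRoot dg π h y) :
    ∃ (W : ℕ → HE k dg) (m : ℕ), IsUnicyclicWalk π Up a W m ∧ t ≤ m ∧
      (∀ i (hi : i < P.length), W i = P[i]) ∧ (W m = a ∨ W m = π a) := by
  obtain ⟨Q, rfl⟩ : ∃ Q, P = Q ++ [y] := by
    rw [List.getLast?_eq_some_iff] at hlast
    exact hlast
  have hQ : Q.length = t := by simpa using hlen
  have hext : ∀ p : List (HE k dg), p.IsChain (NBStep π) → p.head? = some y →
      p.length ≤ h + 1 →
      IsUnicyclicWalk π Up a (fun i => (Q ++ p).getD i x) (t + (p.length - 1)) := by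
    intro p hp hpy hpl
    obtain ⟨p', rfl⟩ : ∃ p', p = y :: p' := by
      cases p with
      | nil => simp at hpy
      | cons w q' => exact ⟨q', by simpa using hpy⟩
    have hchain : (Q ++ y :: p').IsChain (NBStep π) := by
      rw [List.isChain_split]
      exact ⟨hP, hp⟩
    have h0 : (Q ++ y :: p').getD 0 x = x := by
      cases Q with
      | nil => simpa using hhead
      | cons w q' => simpa using hhead
    have hst : ∀ i < t + ((y :: p').length - 1), NBStep π ((fun i => (Q ++ y :: p').getD i x) i)
        ((fun i => (Q ++ y :: p').getD i x) (i + 1)) := fun i hi =>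
      isChain_getD_step hchain x i (by simp at hi ⊢; omega)
    refine ⟨hst, fun i hi => hcov _ ?_⟩
    have := mem_ballHEs_of_steps (r := r) (by simp at hpl ⊢; omega) hst i hi
    rwa [h0] at this
  by_contra hcon
  refine hy fun p q hp hq hpy hqy hpl hql hpq => ?_
  rw [isNBPath_iff_isChain] at hp hq
  have htree : ∀ p : List (HE k dg), p.IsChain (NBStep π) → p.head? = some y →
      p.length ≤ h + 1 → IsForestWalk π Up (fun i => p.getD i x) (p.length - 1) := by
    intro p hp hpy hpl
    have hW := hext p hp hpy hpl
    have hshift : (fun i => (Q ++ p).getD (t + i) x) = fun i => p.getD i x := by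
      funext i
      rw [List.getD_append_right _ _ _ _ (by omega), hQ, Nat.add_sub_cancel_left]
    have hd := hW.drop (j := t) (m := p.length - 1) le_rfl
    rw [hshift] at hd
    refine hd.isForestWalk fun i hi hia => hcon ⟨_, t + i, hW.mono (by omega), by omega, ?_, ?_⟩
    · intro j hj
      have hpne : 0 < p.length := by omega
      simp only [List.length_append, List.length_cons, List.length_nil] at hj
      change (Q ++ p).getD j x = _
      rcases Nat.lt_or_ge j Q.length with h' | h'
      · rw [List.getD_append _ _ _ _ h', List.getD_eq_getElem _ _ h', List.getElem_append_left h']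
      · obtain rfl : j = Q.length := by omega
        rw [List.getD_append_right _ _ _ _ le_rfl]
        simp [List.head?_eq_getElem?] at hpy ⊢
        simp [hpy]
    · rw [← congrFun hshift i] at hia
      exact hia
  have hpp : 0 < p.length := List.length_pos_iff.2 fun h => by simp [h] at hpy
  have hqp : 0 < q.length := List.length_pos_iff.2 fun h => by simp [h] at hqy
  have hz : ∀ p : List (HE k dg), p.head? = some y → p.getD 0 x = y := fun p hp => by
    rw [List.getD_eq_getElem?_getD, ← List.head?_eq_getElem?, hp]
    rfl
  have hl : p.getD (p.length - 1) x = q.getD (q.length - 1) x := by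
    rw [List.getD_eq_getElem?_getD, List.getD_eq_getElem?_getD, ← List.getLast?_eq_getElem?,
      ← List.getLast?_eq_getElem?, hpq]
  obtain ⟨e, hi⟩ := (htree p hp hpy hpl).unique hπ hF (htree q hq hqy hql)
    (by simp only [hz p hpy, hz q hqy]) (by simp only [hl])
  refine List.ext_getElem (by omega) fun i h1 h2 => ?_
  rw [← List.getD_eq_getElem _ x h1, ← List.getD_eq_getElem _ x h2]
  rcases Nat.lt_or_ge i (p.length - 1) with h' | h'
  · exact hi i h'
  · rw [show i = p.length - 1 by omega, hl, e]

end Roots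

/-- **Deterministic root-reaching bound**: if all degrees are at least 3 and no ball
of radius `r` in `G(π)` contains more than one cycle, then for `h ≤ r` the NBRW
started from any `x` satisfies `P(X_t is not a root) ≤ 2^{1-t}` for `1 ≤ t ≤ r - h`. -/
theorem deterministic_root_reaching {k : ℕ} (dg : Fin k → ℕ) (hdg : ∀ v, 3 ≤ dg v)
    (π : Equiv.Perm (HE k dg)) (hπ : IsPairing π) (r h : ℕ) (hh : h ≤ r)
    (hball : ∀ x : HE k dg, (ballHEs dg π r x).card ≤ 2 * (ballVerts dg π r x).card)
    (x : HE k dg) (t : ℕ) (ht1 : 1 ≤ t) (ht2 : t ≤ r - h) :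
    ∑ y ∈ univ.filter (fun y => ¬ IsRoot dg π h y), ((nbrwP dg π) ^ t) x y
      ≤ (2 : ℝ) ^ ((1 : ℤ) - (t : ℤ)) := by
  have hr : t + h ≤ r := by omega
  obtain ⟨d, Up, a, hF, hcov⟩ := exists_isForest_extra hπ r x (hball x)
  obtain ⟨S, hS, hle⟩ := exists_paths_sum_pow_le (π := π) hdg
    (univ.filter fun y => ¬ IsRoot dg π h y) t x
  refine hle.trans ?_
  have hext : ∀ P : List (HE k dg), ∃ (W : ℕ → HE k dg) (m : ℕ), P ∈ S →
      IsUnicyclicWalk π Up a W m ∧ t ≤ m ∧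
        (∀ i (hi : i < P.length), W i = P[i]) ∧ (W m = a ∨ W m = π a) := by
    intro P
    by_cases hP : P ∈ S
    · obtain ⟨h1, h2, h3, y, hy, h4⟩ := hS P hP
      obtain ⟨W, m, hW⟩ := exists_extension_extra hπ hF hr hcov h3 h1 h2 h4
        (Finset.mem_filter.1 hy).2
      exact ⟨W, m, fun _ => hW⟩
    · exact ⟨fun _ => x, 0, fun h => absurd h hP⟩
  choose W m hW using hext
  have hcard : S.card ≤ ({a, π a} : Finset (HE k dg)).card := by
    refine Finset.card_le_card_of_injOn (fun P => W P (m P)) (fun P hP => ?_)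
      fun P hP P' hP' he => ?_
    · simpa using (hW P hP).2.2.2
    · obtain ⟨hw, htm, hag, hex⟩ := hW P hP
      obtain ⟨hw', htm', hag', -⟩ := hW P' hP'
      have hl := (hS P hP).1
      have hl' := (hS P' hP').1
      have h0 : ∀ Q (hQ : Q ∈ S), W Q 0 = x := fun Q hQ => by
        obtain ⟨hlen, hhead, -⟩ := hS Q hQ
        rw [(hW Q hQ).2.2.1 0 (by omega)]
        rw [List.head?_eq_getElem?, List.getElem?_eq_getElem (by omega)] at hhead
        exact Option.some_injective _ hhead
      refine List.ext_getElem (by omega) fun i h1 h2 => ?_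
      rw [← hag i h1, ← hag' i h2]
      exact hw.eq_of_extra hπ hF hw' (by rw [h0 P hP, h0 P' hP']) hex he i (by omega) (by omega)
  have hS2 : (S.card : ℝ) ≤ 2 := by exact_mod_cast hcard.trans Finset.card_le_two
  calc (1 / 2 : ℝ) ^ t * S.card ≤ (1 / 2 : ℝ) ^ t * 2 := by gcongr
    _ = (2 : ℝ) ^ ((1 : ℤ) - (t : ℤ)) := by
      rw [zpow_sub₀ (by norm_num), zpow_one, zpow_natCast, one_div, inv_pow]
      ring

end
end

section
/- Restriction decomposition of the distance to stationarity: let P be any doubly stochastic transition matrix on a finite state space X of size N, let R ⊆ X, and let s, t ∈ ℕ. Then D(t+s) ≤ max_{x∈X} P^s(x, X∖R) + max_{x∈R} D_x(t), where P^s(x,A) := Σ_{y∈A} P^s(x,y). -/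
open Finset

noncomputable section

/-- The total variation distance between a probability vector and the uniform one is at most `1`. -/
lemma half_sum_abs_sub_inv_card_le_one {X : Type*} [Fintype X] [Nonempty X] {p : X → ℝ}
    (hp : ∀ y, 0 ≤ p y) (hsum : ∑ y, p y = 1) :
    (1 / 2) * ∑ y, |p y - (Fintype.card X : ℝ)⁻¹| ≤ 1 := by
  have hcard : (Fintype.card X : ℝ) ≠ 0 := by simp
  have h : ∑ y, |p y - (Fintype.card X : ℝ)⁻¹| ≤ ∑ y, (p y + (Fintype.card X : ℝ)⁻¹) := by
    refine sum_le_sum fun y _ => (abs_sub _ _).trans ?_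
    rw [abs_of_nonneg (hp y), abs_of_nonneg (by positivity)]
  rw [sum_add_distrib, hsum, sum_const, card_univ, nsmul_eq_mul, mul_inv_cancel₀ hcard] at h
  linarith

/-- Averaging the rows of a matrix by a probability vector is a contraction for the
`ℓ¹` distance to a constant. -/
lemma sum_abs_mul_apply_sub_le {X : Type*} [Fintype X] {Q T : Matrix X X ℝ} {x : X}
    (hQ : ∀ z, 0 ≤ Q x z) (hsum : ∑ z, Q x z = 1) (c : ℝ) :
    ∑ y, |(Q * T) x y - c| ≤ ∑ z, Q x z * ∑ y, |T z y - c| := by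
  simp_rw [mul_sum]
  rw [sum_comm]
  refine sum_le_sum fun y _ => ?_
  have h : (Q * T) x y - c = ∑ z, Q x z * (T z y - c) := by
    simp_rw [mul_sub, sum_sub_distrib, ← sum_mul, hsum, one_mul, Matrix.mul_apply]
  rw [h]
  refine (abs_sum_le_sum_abs _ _).trans_eq (sum_congr rfl fun z _ => ?_)
  rw [abs_mul, abs_of_nonneg (hQ z)]

/-- **Restriction decomposition of the distance to stationarity**: for any doubly
stochastic transition matrix `P` on a finite state space `X` of size `N`, any
`R ⊆ X` and any `s, t ∈ ℕ`,
`𝒟(t+s) ≤ max_{x ∈ X} P^s(x, X ∖ R) + max_{x ∈ R} 𝒟_x(t)`. -/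
theorem restriction_decomposition (X : Type) [Fintype X] [DecidableEq X] [Nonempty X]
    (P : Matrix X X ℝ) (hnn : ∀ x y, 0 ≤ P x y)
    (hrow : ∀ x, ∑ y, P x y = 1) (hcol : ∀ y, ∑ x, P x y = 1)
    (R : Finset X) (s t : ℕ) :
    (⨆ x : X, (1 / 2) * ∑ y, |(P ^ (t + s)) x y - (Fintype.card X : ℝ)⁻¹|)
      ≤ (⨆ x : X, ∑ y ∈ Rᶜ, (P ^ s) x y)
        + ⨆ x : {z // z ∈ R}, (1 / 2) * ∑ y, |(P ^ t) x.1 y - (Fintype.card X : ℝ)⁻¹| := by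
  have hP : P ∈ Matrix.rowStochastic ℝ X := Matrix.mem_rowStochastic_iff_sum.2 ⟨hnn, hrow⟩
  have hpow (n : ℕ) : (∀ x y, 0 ≤ (P ^ n) x y) ∧ ∀ x, ∑ y, (P ^ n) x y = 1 :=
    Matrix.mem_rowStochastic_iff_sum.1 (pow_mem hP n)
  obtain ⟨hQ, hQsum⟩ := hpow s
  obtain ⟨hT, hTsum⟩ := hpow t
  set B : ℝ := ⨆ x : {z // z ∈ R}, (1 / 2) * ∑ y, |(P ^ t) x.1 y - (Fintype.card X : ℝ)⁻¹|
  have hB : 0 ≤ B := Real.iSup_nonneg fun x => by positivity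
  have hle (z : X) (hz : z ∈ R) :
      (1 / 2) * ∑ y, |(P ^ t) z y - (Fintype.card X : ℝ)⁻¹| ≤ B :=
    le_ciSup (f := fun x : {z // z ∈ R} =>
      (1 / 2) * ∑ y, |(P ^ t) x.1 y - (Fintype.card X : ℝ)⁻¹|)
      (Set.finite_range _).bddAbove ⟨z, hz⟩
  refine ciSup_le fun x => ?_
  have hescape : ∑ y ∈ Rᶜ, (P ^ s) x y ≤ ⨆ x : X, ∑ y ∈ Rᶜ, (P ^ s) x y :=
    le_ciSup (f := fun x : X => ∑ y ∈ Rᶜ, (P ^ s) x y) (Set.finite_range _).bddAbove x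
  have hmass : ∑ z ∈ R, (P ^ s) x z ≤ 1 :=
    (sum_le_univ_sum_of_nonneg (hQ x)).trans_eq (hQsum x)
  calc (1 / 2) * ∑ y, |(P ^ (t + s)) x y - (Fintype.card X : ℝ)⁻¹|
      ≤ (1 / 2) * ∑ z, (P ^ s) x z * ∑ y, |(P ^ t) z y - (Fintype.card X : ℝ)⁻¹| := by
        rw [add_comm t s, pow_add]
        exact mul_le_mul_of_nonneg_left (sum_abs_mul_apply_sub_le (hQ x) (hQsum x) _)
          (by norm_num)
    _ = ∑ z ∈ Rᶜ, (P ^ s) x z * ((1 / 2) * ∑ y, |(P ^ t) z y - (Fintype.card X : ℝ)⁻¹|)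
        + ∑ z ∈ R, (P ^ s) x z * ((1 / 2) * ∑ y, |(P ^ t) z y - (Fintype.card X : ℝ)⁻¹|) := by
        rw [sum_compl_add_sum, mul_sum]
        exact sum_congr rfl fun z _ => mul_left_comm _ _ _
    _ ≤ ∑ z ∈ Rᶜ, (P ^ s) x z + ∑ z ∈ R, (P ^ s) x z * B :=
        add_le_add
          (sum_le_sum fun z _ => mul_le_of_le_one_right (hQ x z)
            (half_sum_abs_sub_inv_card_le_one (hT z) (hTsum z)))
          (sum_le_sum fun z hz => mul_le_mul_of_nonneg_left (hle z hz) (hQ x z))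
    _ ≤ _ := by
        rw [← sum_mul]
        exact add_le_add hescape (mul_le_of_le_one_left hB hmass)

end
end

section
/- Exchangeability of the random switch: let I be a finite set of even cardinality ≥ 2, π a uniformly random pairing of I, and π′ the pairing obtained from π by sampling two indices i ≠ j uniformly without replacement from I and replacing the pairs {i, π(i)}, {j, π(j)} with {i, j}, {π(i), π(j)}. Then (π, π′) has the same joint distribution as (π′, π); in particular, for Y := Σ_{i∈I} w_{i,π(i)} − m and Y′ := Σ_{i∈I} w_{i,π′(i)} − m with any non-negative weight array {w_{i,j}} and any constant m, the pair (Y, Y′) is exchangeable. -/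
open Classical Finset

noncomputable section

/-- The finite set of all pairings (fixed-point-free involutions) of `ι`. -/
def PairingsI (ι : Type) [Fintype ι] [DecidableEq ι] : Finset (Equiv.Perm ι) :=
  univ.filter fun π => (∀ x, π (π x) = x) ∧ ∀ x, π x ≠ x

/-- The random switch: the pairing obtained from `π` by replacing the pairs
`{i, π i}` and `{j, π j}` with `{i, j}` and `{π i, π j}`. (For a fixed-point-free
involution `π` and `i ≠ j` this permutation sends `i ↦ j`, `j ↦ i`,
`π i ↦ π j`, `π j ↦ π i`, and agrees with `π` elsewhere.) -/
def switchPerm {ι : Type} [DecidableEq ι] (π : Equiv.Perm ι) (i j : ι) :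
    Equiv.Perm ι :=
  π * (Equiv.swap i (π j) * Equiv.swap j (π i))

theorem mem_PairingsI {ι : Type} [Fintype ι] [DecidableEq ι] {π : Equiv.Perm ι} :
    π ∈ PairingsI ι ↔ (∀ x, π (π x) = x) ∧ ∀ x, π x ≠ x := by
  simp [PairingsI]

theorem switchPerm_apply {ι : Type} [DecidableEq ι] {π : Equiv.Perm ι}
    (hinv : ∀ x, π (π x) = x) (hfix : ∀ x, π x ≠ x) {i j : ι} (hij : i ≠ j) (x : ι) :
    switchPerm π i j x =
      if x = i then j else if x = j then i else
      if x = π i then π j else if x = π j then π i else π x := by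
  have hπ : π i ≠ π j := π.injective.ne hij
  have hi := hfix i
  have hj := hfix j
  have hii := hinv i
  have hjj := hinv j
  simp only [switchPerm, Equiv.Perm.mul_apply, Equiv.swap_apply_def]
  grind

theorem switchPerm_apply_left {ι : Type} [DecidableEq ι] {π : Equiv.Perm ι}
    (hinv : ∀ x, π (π x) = x) (hfix : ∀ x, π x ≠ x) {i j : ι} (hij : i ≠ j) :
    switchPerm π i j i = j := by
  simp [switchPerm_apply hinv hfix hij]

theorem switchPerm_mem_PairingsI {ι : Type} [Fintype ι] [DecidableEq ι] {π : Equiv.Perm ι}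
    (hπ : π ∈ PairingsI ι) {i j : ι} (hij : i ≠ j) : switchPerm π i j ∈ PairingsI ι := by
  obtain ⟨hinv, hfix⟩ := mem_PairingsI.1 hπ
  have hinj : π i ≠ π j := π.injective.ne hij
  refine mem_PairingsI.2 ⟨fun x => ?_, fun x => ?_⟩ <;>
  · have hx := hinv x
    have hx' := hfix x
    have hi := hfix i
    have hj := hfix j
    have hii := hinv i
    have hjj := hinv j
    simp only [switchPerm_apply hinv hfix hij]
    grind

/-- Switching `π` at `i, j` is undone by switching the result at `i, π i`. -/
theorem switchPerm_switchPerm {ι : Type} [Fintype ι] [DecidableEq ι] {π : Equiv.Perm ι}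
    (hπ : π ∈ PairingsI ι) {i j : ι} (hij : i ≠ j) :
    switchPerm (switchPerm π i j) i (π i) = π := by
  obtain ⟨hinv, hfix⟩ := mem_PairingsI.1 hπ
  obtain ⟨hinv', hfix'⟩ := mem_PairingsI.1 (switchPerm_mem_PairingsI hπ hij)
  ext x
  have hinj : π i ≠ π j := π.injective.ne hij
  have hx := hinv x
  have hi := hfix i
  have hj := hfix j
  have hii := hinv i
  have hjj := hinv j
  rw [switchPerm_apply hinv' hfix' hi.symm]
  simp only [switchPerm_apply hinv hfix hij]
  grind

/-- The reversal `(π, i, j) ↦ (switchPerm π i j, i, π i)` of the sample space exchanges a pairing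
with its switch. -/
theorem card_filter_switchPerm_comm {ι : Type} [Fintype ι] [DecidableEq ι]
    (r s : Equiv.Perm ι → Prop)
    [DecidablePred fun ω : Equiv.Perm ι × ι × ι => r ω.1 ∧ s (switchPerm ω.1 ω.2.1 ω.2.2)]
    [DecidablePred fun ω : Equiv.Perm ι × ι × ι => s ω.1 ∧ r (switchPerm ω.1 ω.2.1 ω.2.2)] :
    (((PairingsI ι) ×ˢ (univ.offDiag : Finset (ι × ι))).filter fun ω =>
        r ω.1 ∧ s (switchPerm ω.1 ω.2.1 ω.2.2)).card =
    (((PairingsI ι) ×ˢ (univ.offDiag : Finset (ι × ι))).filter fun ω =>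
        s ω.1 ∧ r (switchPerm ω.1 ω.2.1 ω.2.2)).card := by
  let F : Equiv.Perm ι × ι × ι → Equiv.Perm ι × ι × ι :=
    fun ω => (switchPerm ω.1 ω.2.1 ω.2.2, ω.2.1, ω.1 ω.2.1)
  refine card_nbij' F F ?_ ?_ ?_ ?_ <;>
  · rintro ⟨π, i, j⟩ h
    simp only [coe_filter, mem_product, mem_offDiag, mem_univ, true_and, Set.mem_ofPred_eq] at h
    obtain ⟨⟨hπ, hij⟩, h₁, h₂⟩ := h
    obtain ⟨hinv, hfix⟩ := mem_PairingsI.1 hπ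
    simp [F, switchPerm_mem_PairingsI hπ hij, switchPerm_switchPerm hπ hij,
      switchPerm_apply_left hinv hfix hij, (hfix i).symm, h₁, h₂]

/-- **Exchangeability of the random switch**: for `π` a uniform pairing of `ι` and
`π′` its random switch (by a uniform ordered pair of distinct indices), the joint
law of `(π, π′)` is symmetric; in particular, for `Y = Σ_i w_{i,π(i)} - m` and
`Y′ = Σ_i w_{i,π′(i)} - m`, the pair `(Y, Y′)` is exchangeable. (Equality of the
corresponding counts in the uniform sample space expresses equality of laws.) -/
theorem switch_exchangeable (ι : Type) [Fintype ι] [DecidableEq ι]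
    (heven : Even (Fintype.card ι)) (hcard : 2 ≤ Fintype.card ι) :
    (∀ a b : Equiv.Perm ι,
      (((PairingsI ι) ×ˢ (univ.offDiag : Finset (ι × ι))).filter fun ω =>
          ω.1 = a ∧ switchPerm ω.1 ω.2.1 ω.2.2 = b).card =
      (((PairingsI ι) ×ˢ (univ.offDiag : Finset (ι × ι))).filter fun ω =>
          ω.1 = b ∧ switchPerm ω.1 ω.2.1 ω.2.2 = a).card)
    ∧ ∀ (w : ι → ι → ℝ), (∀ i j, 0 ≤ w i j) → ∀ (m yv yv' : ℝ),
      (((PairingsI ι) ×ˢ (univ.offDiag : Finset (ι × ι))).filter fun ω =>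
          (∑ i, w i (ω.1 i)) - m = yv ∧
          (∑ i, w i (switchPerm ω.1 ω.2.1 ω.2.2 i)) - m = yv').card =
      (((PairingsI ι) ×ˢ (univ.offDiag : Finset (ι × ι))).filter fun ω =>
          (∑ i, w i (ω.1 i)) - m = yv' ∧
          (∑ i, w i (switchPerm ω.1 ω.2.1 ω.2.2 i)) - m = yv).card := by
  exact ⟨fun a b => card_filter_switchPerm_comm (· = a) (· = b), fun w _ m yv yv' =>
    card_filter_switchPerm_comm (fun π => (∑ i, w i (π i)) - m = yv)
      (fun π => (∑ i, w i (π i)) - m = yv')⟩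

end
end

section
/- Stein-pair linearity for the random switch: in the setting of the random switch on a uniform pairing, with Y := Σ_{i∈I} w_{i,π(i)} − m where m := (1/(|I|−1)) Σ_{i∈I} Σ_{j≠i} w_{i,j}, and Y′ the corresponding quantity for the switched pairing π′, one has E[Y′ − Y | π] = −(4/|I|)·Y almost surely. -/
open Classical Finset

noncomputable section

/-- The change in `∑ x, w x (π x)` along the switch of `π` at `i ≠ j`. -/
lemma sum_switchPerm_sub {ι : Type} [Fintype ι] [DecidableEq ι] (w : ι → ι → ℝ)
    {π : Equiv.Perm ι} (hπ1 : ∀ x, π (π x) = x) (hπ2 : ∀ x, π x ≠ x) {i j : ι} (hij : i ≠ j) :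
    (∑ x, w x (switchPerm π i j x)) - ∑ x, w x (π x) =
      w i j + w j i + w (π i) (π j) + w (π j) (π i)
        - w i (π i) - w (π i) i - w j (π j) - w (π j) j := by
  have hinj : π i ≠ π j := fun h => hij (π.injective h)
  by_cases hj : j = π i
  · subst hj
    have hs : switchPerm π i (π i) = π := by
      ext x
      simp [switchPerm, hπ1]
    rw [hs, hπ1]
    ring
  · have hi : i ≠ π j := fun h => hj (by rw [h, hπ1])
    have h1 : switchPerm π i j i = j := by
      simp [switchPerm, Equiv.swap_apply_of_ne_of_ne hij (hπ2 i).symm, hπ1]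
    have h2 : switchPerm π i j j = i := by
      simp [switchPerm, Equiv.swap_apply_of_ne_of_ne (hπ2 i) hinj, hπ1]
    have h3 : switchPerm π i j (π i) = π j := by
      simp [switchPerm, Equiv.swap_apply_of_ne_of_ne hij.symm (hπ2 j).symm]
    have h4 : switchPerm π i j (π j) = π i := by
      simp [switchPerm, Equiv.swap_apply_of_ne_of_ne (hπ2 j) hinj.symm]
    have h5 : ∀ x ∈ (univ : Finset ι), x ∉ ({i, j, π i, π j} : Finset ι) →
        w x (switchPerm π i j x) - w x (π x) = 0 := by
      intro x _ hx
      simp only [mem_insert, mem_singleton, not_or] at hx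
      obtain ⟨hxi, hxj, hxpi, hxpj⟩ := hx
      simp [switchPerm, Equiv.swap_apply_of_ne_of_ne hxj hxpi,
        Equiv.swap_apply_of_ne_of_ne hxi hxpj]
    rw [← sum_sub_distrib, ← sum_subset (subset_univ _) h5,
      sum_insert (by simp [hij, (hπ2 i).symm, hi]),
      sum_insert (by simp [hj, (hπ2 j).symm]),
      sum_insert (by simp [hij]), sum_singleton, h1, h2, h3, h4, hπ1, hπ1]
    ring

/-- A sum over ordered pairs of distinct elements, as an iterated sum. -/
lemma sum_offDiag_eq_sum_erase {ι : Type} [Fintype ι] [DecidableEq ι] (f : ι → ι → ℝ) :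
    ∑ p ∈ (univ.offDiag : Finset (ι × ι)), f p.1 p.2 = ∑ i, ∑ j ∈ univ.erase i, f i j :=
  sum_finset_product' _ _ _ (by simp [eq_comm])

/-- Summing a function of the first coordinate over ordered pairs of distinct elements. -/
lemma sum_offDiag_fst {ι : Type} [Fintype ι] [DecidableEq ι] [Nonempty ι] (g : ι → ℝ) :
    ∑ p ∈ (univ.offDiag : Finset (ι × ι)), g p.1 = ((Fintype.card ι : ℝ) - 1) * ∑ i, g i := by
  rw [sum_offDiag_eq_sum_erase fun i _ => g i, mul_sum]
  refine sum_congr rfl fun i _ => ?_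
  rw [sum_const, card_erase_of_mem (mem_univ i), card_univ, nsmul_eq_mul,
    Nat.cast_pred Fintype.card_pos]

/-- Sums over ordered pairs of distinct elements are invariant under exchanging coordinates. -/
lemma sum_offDiag_swap {ι : Type} [Fintype ι] [DecidableEq ι] (f : ι → ι → ℝ) :
    ∑ p ∈ (univ.offDiag : Finset (ι × ι)), f p.2 p.1 =
      ∑ p ∈ (univ.offDiag : Finset (ι × ι)), f p.1 p.2 :=
  sum_equiv (Equiv.prodComm ι ι) (by simp [eq_comm]) (by simp)

/-- Sums over ordered pairs of distinct elements are invariant under permuting the elements. -/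
lemma sum_offDiag_perm {ι : Type} [Fintype ι] [DecidableEq ι] (f : ι → ι → ℝ)
    (π : Equiv.Perm ι) :
    ∑ p ∈ (univ.offDiag : Finset (ι × ι)), f (π p.1) (π p.2) =
      ∑ p ∈ (univ.offDiag : Finset (ι × ι)), f p.1 p.2 :=
  sum_equiv (Equiv.prodCongr π π) (by simp) (by simp)

/-- **Stein-pair linearity for the random switch**: with
`Y = Σ_i w_{i,π(i)} - m`, `m = (|I|-1)⁻¹ Σ_i Σ_{j≠i} w_{i,j}`, and `Y′` the
corresponding quantity for the switched pairing, one has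
`E[Y′ - Y | π] = -(4/|I|) Y` (the conditional expectation being the average over
the uniform ordered pair of distinct switch indices). -/
theorem stein_pair_linearity (ι : Type) [Fintype ι] [DecidableEq ι]
    (heven : Even (Fintype.card ι)) (hcard : 2 ≤ Fintype.card ι)
    (w : ι → ι → ℝ) (hw : ∀ i j, 0 ≤ w i j) (m : ℝ)
    (hm : m = ((Fintype.card ι : ℝ) - 1)⁻¹ * ∑ i, ∑ j ∈ univ.erase i, w i j)
    (π : Equiv.Perm ι) (hπ1 : ∀ x, π (π x) = x) (hπ2 : ∀ x, π x ≠ x) :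
    ((Fintype.card ι : ℝ) * ((Fintype.card ι : ℝ) - 1))⁻¹ *
        ∑ p ∈ (univ.offDiag : Finset (ι × ι)),
          ((∑ i, w i (switchPerm π p.1 p.2 i)) - ∑ i, w i (π i))
      = -(4 / (Fintype.card ι : ℝ)) * ((∑ i, w i (π i)) - m) := by
  have : Nonempty ι := Fintype.card_pos_iff.mp (by omega)
  have hn : (2 : ℝ) ≤ Fintype.card ι := by exact_mod_cast hcard
  have hn0 : (Fintype.card ι : ℝ) ≠ 0 := by linarith
  have hn1 : (Fintype.card ι : ℝ) - 1 ≠ 0 := by linarith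
  have hinv : ∑ i, w (π i) i = ∑ i, w i (π i) :=
    Fintype.sum_equiv π _ _ fun i => by rw [hπ1]
  have hsnd (g : ι → ℝ) : ∑ p ∈ (univ.offDiag : Finset (ι × ι)), g p.2 =
      ((Fintype.card ι : ℝ) - 1) * ∑ i, g i := by
    rw [sum_offDiag_swap fun i _ => g i, sum_offDiag_fst]
  rw [sum_congr rfl fun p hp => sum_switchPerm_sub w hπ1 hπ2 (mem_offDiag.mp hp).2.2]
  simp only [sum_sub_distrib, sum_add_distrib]
  rw [sum_offDiag_swap w, sum_offDiag_perm w π, sum_offDiag_perm (fun i j => w j i) π,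
    sum_offDiag_swap w, sum_offDiag_fst fun i => w i (π i), sum_offDiag_fst fun i => w (π i) i,
    hsnd fun i => w i (π i), hsnd fun i => w (π i) i, hinv, hm, sum_offDiag_eq_sum_erase w]
  field_simp
  ring

end
end
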